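/- arXiv:0904.3462 — 9 statements merged into one kernel-verified Lean document; each statement's English description precedes it below -/
import Mathlib

section
/- (Hyers' theorem) Let E and E' be real Banach spaces, δ > 0, and let f : E → E' be a mapping such that ‖f(x+y) − f(x) − f(y)‖ ≤ δ for all x, y ∈ E. Then there exists a unique additive mapping T : E → E' (i.e., T(x+y) = T(x) + T(y) for all x, y ∈ E) such that ‖f(x) − T(x)‖ ≤ δ for all x ∈ E. -/
open Filter Topology

/-- A bounded additive map from an additive monoid to a real normed space vanishes. -/
theorem AddMonoidHom.eq_zero_of_norm_le {A F : Type*} [AddMonoid A] [NormedAddCommGroup F]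
    [NormedSpace ℝ F] (D : A →+ F) {C : ℝ} (hD : ∀ x, ‖D x‖ ≤ C) : D = 0 := by
  ext x
  by_contra h
  have hpos : 0 < ‖D x‖ := norm_pos_iff.mpr h
  obtain ⟨n, hn⟩ := exists_nat_gt (C / ‖D x‖)
  have hle := hD (n • x)
  rw [map_nsmul, ← Nat.cast_smul_eq_nsmul ℝ, norm_smul, RCLike.norm_natCast] at hle
  exact absurd hle (not_le.mpr ((div_lt_iff₀ hpos).mp hn))

/-- The `n`-th term of the Hyers sequence `2⁻ⁿ f (2ⁿ x)`. -/
noncomputable def hyersSeq {A F : Type*} [AddMonoid A] [NormedAddCommGroup F] [NormedSpace ℝ F]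
    (f : A → F) (x : A) (n : ℕ) : F :=
  ((2 : ℝ) ^ n)⁻¹ • f (2 ^ n • x)

section HyersSeq

variable {A F : Type*} [AddCommMonoid A] [NormedAddCommGroup F] [NormedSpace ℝ F]
  {f : A → F} {δ : ℝ}

theorem dist_hyersSeq_succ_le (hf : ∀ x y, ‖f (x + y) - f x - f y‖ ≤ δ) (x : A) (n : ℕ) :
    dist (hyersSeq f x n) (hyersSeq f x (n + 1)) ≤ δ / 2 / 2 ^ n := by
  have key : hyersSeq f x (n + 1) - hyersSeq f x n = ((2 : ℝ) ^ (n + 1))⁻¹ •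
      (f (2 ^ n • x + 2 ^ n • x) - f (2 ^ n • x) - f (2 ^ n • x)) := by
    have hx : 2 ^ (n + 1) • x = 2 ^ n • x + 2 ^ n • x := by
      rw [← add_nsmul, pow_succ, mul_two]
    rw [hyersSeq, hyersSeq, hx, pow_succ]
    module
  rw [dist_comm, dist_eq_norm, key, norm_smul, Real.norm_of_nonneg (by positivity)]
  calc ((2 : ℝ) ^ (n + 1))⁻¹ * _ ≤ ((2 : ℝ) ^ (n + 1))⁻¹ * δ := by gcongr; exact hf _ _
    _ = δ / 2 / 2 ^ n := by field_simp; ring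

theorem norm_hyersSeq_add_sub_le (hf : ∀ x y, ‖f (x + y) - f x - f y‖ ≤ δ) (x y : A) (n : ℕ) :
    ‖hyersSeq f (x + y) n - hyersSeq f x n - hyersSeq f y n‖ ≤ ((2 : ℝ) ^ n)⁻¹ * δ := by
  simp only [hyersSeq]
  rw [← smul_sub, ← smul_sub, norm_smul, Real.norm_of_nonneg (by positivity), nsmul_add]
  gcongr
  exact hf _ _

end HyersSeq

/-- Hyers' theorem: an approximately additive map between real Banach spaces is uniformly
close to a unique additive map. -/
theorem stmt_3 {E E' : Type*} [NormedAddCommGroup E] [NormedSpace ℝ E] [CompleteSpace E]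
    [NormedAddCommGroup E'] [NormedSpace ℝ E'] [CompleteSpace E']
    (δ : ℝ) (hδ : 0 < δ) (f : E → E')
    (hf : ∀ x y : E, ‖f (x + y) - f x - f y‖ ≤ δ) :
    ∃! T : E → E', (∀ x y : E, T (x + y) = T x + T y) ∧ ∀ x : E, ‖f x - T x‖ ≤ δ := by
  choose T hT using fun x => cauchySeq_tendsto_of_complete
    (cauchySeq_of_le_geometric_two (dist_hyersSeq_succ_le hf x))
  have hadd : ∀ x y, T (x + y) = T x + T y := by
    intro x y
    have hdiff := ((hT (x + y)).sub (hT x)).sub (hT y)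
    have hbound : Tendsto (fun n : ℕ => ((2 : ℝ) ^ n)⁻¹ * δ) atTop (𝓝 0) := by
      simpa using (tendsto_inv_atTop_zero.comp
        (tendsto_pow_atTop_atTop_of_one_lt (one_lt_two : (1 : ℝ) < 2))).mul_const δ
    have hzero := tendsto_nhds_unique hdiff
      (squeeze_zero_norm (norm_hyersSeq_add_sub_le hf x y) hbound)
    rwa [sub_sub, sub_eq_zero] at hzero
  have hclose : ∀ x, ‖f x - T x‖ ≤ δ := by
    intro x
    simpa [hyersSeq, dist_eq_norm] using
      dist_le_of_le_geometric_two_of_tendsto₀ (dist_hyersSeq_succ_le hf x) (hT x)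
  refine ⟨T, ⟨hadd, hclose⟩, ?_⟩
  rintro S ⟨hSadd, hSclose⟩
  have hD : AddMonoidHom.mk' S hSadd - AddMonoidHom.mk' T hadd = 0 := by
    refine AddMonoidHom.eq_zero_of_norm_le _ (C := δ + δ) fun x => ?_
    calc ‖S x - T x‖ = ‖(f x - T x) - (f x - S x)‖ := by congr 1; abel
      _ ≤ δ + δ := norm_sub_le_of_le (hclose x) (hSclose x)
  funext x
  exact sub_eq_zero.mp (DFunLike.congr_fun hD x)
end

section
/- (Hyers' theorem, linearity part) Let E and E' be real Banach spaces, δ > 0, and let f : E → E' satisfy ‖f(x+y) − f(x) − f(y)‖ ≤ δ for all x, y ∈ E. If moreover the map t ↦ f(tx) from ℝ into E' is continuous for each fixed x ∈ E, then the unique additive mapping T : E → E' with ‖f(x) − T(x)‖ ≤ δ for all x ∈ E is real-linear. -/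
/-- Hyers' theorem, linearity part: if moreover `t ↦ f (t • x)` is continuous for each
fixed `x`, then the unique additive map `T` with `‖f x - T x‖ ≤ δ` is real-linear. -/
theorem stmt_4 {E E' : Type*} [NormedAddCommGroup E] [NormedSpace ℝ E] [CompleteSpace E]
    [NormedAddCommGroup E'] [NormedSpace ℝ E'] [CompleteSpace E']
    (δ : ℝ) (hδ : 0 < δ) (f : E → E')
    (hf : ∀ x y : E, ‖f (x + y) - f x - f y‖ ≤ δ)
    (hcont : ∀ x : E, Continuous fun t : ℝ => f (t • x)) :
    ∀ T : E → E',
      ((∀ x y : E, T (x + y) = T x + T y) ∧ ∀ x : E, ‖f x - T x‖ ≤ δ) →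
      ∀ (t : ℝ) (x : E), T (t • x) = t • T x := by
  rintro T ⟨hadd, hT⟩ t x
  let g : ℝ →+ E' := AddMonoidHom.mk' (fun s => T (s • x)) fun a b => by
    rw [add_smul, hadd]
  have hg : Continuous g := by
    have hnhds : {s : ℝ | f (s • x) ∈ Metric.ball (f ((0 : ℝ) • x)) 1} ∈ nhds (0 : ℝ) :=
      (hcont x).continuousAt (Metric.ball_mem_nhds _ one_pos)
    refine g.continuous_of_isBounded_nhds_zero hnhds
      ((Metric.isBounded_ball (x := f ((0 : ℝ) • x)) (r := 1 + δ)).subset ?_)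
    rintro _ ⟨s, hs, rfl⟩
    have hdist : dist (T (s • x)) (f (s • x)) ≤ δ := by
      rw [dist_comm, dist_eq_norm]
      exact hT _
    have hs' : dist (f (s • x)) (f ((0 : ℝ) • x)) < 1 := hs
    have htri := dist_triangle (T (s • x)) (f (s • x)) (f ((0 : ℝ) • x))
    change dist (T (s • x)) (f ((0 : ℝ) • x)) < 1 + δ
    linarith
  have h := map_real_smul g hg t 1
  simpa [g] using h
end

section
/- (Rassias' theorem) Let E be a real normed vector space, E' a real Banach space, and let f : E → E' satisfy ‖f(x+y) − f(x) − f(y)‖ ≤ ε(‖x‖^p + ‖y‖^p) for all x, y ∈ E, where ε > 0 and 0 ≤ p < 1 are constants. Then there exists a unique additive mapping T : E → E' such that ‖f(x) − T(x)‖ ≤ (2ε/(2 − 2^p))‖x‖^p for all x ∈ E. -/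
open Filter Topology

theorem norm_two_pow_smul_rpow {E : Type*} [NormedAddCommGroup E] [NormedSpace ℝ E]
    (p : ℝ) (n : ℕ) (x : E) :
    ‖(2 ^ n : ℝ) • x‖ ^ p = ((2 : ℝ) ^ p) ^ n * ‖x‖ ^ p := by
  rw [norm_smul, Real.mul_rpow (norm_nonneg _) (norm_nonneg _), norm_pow, Real.norm_ofNat,
    ← Real.rpow_natCast, ← Real.rpow_mul zero_le_two, mul_comm (n : ℝ) p,
    Real.rpow_mul zero_le_two, Real.rpow_natCast]

theorem map_two_pow_smul_of_map_add {E F : Type*} [AddCommGroup E] [Module ℝ E]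
    [AddCommGroup F] [Module ℝ F] {T : E → F} (hT : ∀ x y, T (x + y) = T x + T y)
    (n : ℕ) (x : E) : T ((2 ^ n : ℝ) • x) = (2 ^ n : ℝ) • T x := by
  have h := map_nsmul (AddMonoidHom.mk' T hT) (2 ^ n) x
  simpa only [AddMonoidHom.mk'_apply, ← Nat.cast_smul_eq_nsmul ℝ, Nat.cast_pow,
    Nat.cast_ofNat] using h

theorem norm_inv_two_pow_smul_le {F : Type*} [NormedAddCommGroup F] [NormedSpace ℝ F]
    {p A : ℝ} {n : ℕ} {v : F} (hv : ‖v‖ ≤ ((2 : ℝ) ^ p) ^ n * A) :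
    ‖((2 : ℝ) ^ n)⁻¹ • v‖ ≤ A * ((2 : ℝ) ^ p / 2) ^ n := by
  rw [norm_smul, norm_inv, norm_pow, Real.norm_ofNat, div_pow]
  calc ((2 : ℝ) ^ n)⁻¹ * ‖v‖ ≤ ((2 : ℝ) ^ n)⁻¹ * (((2 : ℝ) ^ p) ^ n * A) := by gcongr
    _ = A * (((2 : ℝ) ^ p) ^ n / 2 ^ n) := by ring

theorem eq_of_map_add_of_norm_sub_le {E F : Type*} [NormedAddCommGroup E] [NormedSpace ℝ E]
    [NormedAddCommGroup F] [NormedSpace ℝ F] {p C : ℝ} (hp : p < 1) {S T : E → F}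
    (hS : ∀ x y, S (x + y) = S x + S y) (hT : ∀ x y, T (x + y) = T x + T y)
    (h : ∀ x, ‖S x - T x‖ ≤ C * ‖x‖ ^ p) : S = T := by
  have hr : (2 : ℝ) ^ p / 2 < 1 := by
    have := Real.rpow_lt_rpow_of_exponent_lt one_lt_two hp
    rw [Real.rpow_one] at this
    linarith
  funext x
  have hlim : Tendsto (fun n : ℕ => C * ‖x‖ ^ p * ((2 : ℝ) ^ p / 2) ^ n) atTop (𝓝 0) := by
    simpa using (tendsto_pow_atTop_nhds_zero_of_lt_one (by positivity) hr).const_mul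
      (C * ‖x‖ ^ p)
  have hle : ∀ n : ℕ, ‖S x - T x‖ ≤ C * ‖x‖ ^ p * ((2 : ℝ) ^ p / 2) ^ n := fun n => by
    have h1 := h ((2 ^ n : ℝ) • x)
    rw [norm_two_pow_smul_rpow, mul_left_comm] at h1
    have h2 := norm_inv_two_pow_smul_le h1
    rwa [map_two_pow_smul_of_map_add hS, map_two_pow_smul_of_map_add hT, ← smul_sub,
      inv_smul_smul₀ (by positivity)] at h2
  have h0 : ‖S x - T x‖ ≤ 0 := ge_of_tendsto' hlim hle
  exact sub_eq_zero.1 (norm_le_zero_iff.1 h0)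

/-- Rassias' theorem (`0 ≤ p < 1`). -/
theorem stmt_5 {E E' : Type*} [NormedAddCommGroup E] [NormedSpace ℝ E]
    [NormedAddCommGroup E'] [NormedSpace ℝ E'] [CompleteSpace E']
    (ε p : ℝ) (hε : 0 < ε) (hp0 : 0 ≤ p) (hp1 : p < 1) (f : E → E')
    (hf : ∀ x y : E, ‖f (x + y) - f x - f y‖ ≤ ε * (‖x‖ ^ p + ‖y‖ ^ p)) :
    ∃! T : E → E', (∀ x y : E, T (x + y) = T x + T y) ∧
      ∀ x : E, ‖f x - T x‖ ≤ 2 * ε / (2 - 2 ^ p) * ‖x‖ ^ p := by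
  have h2p : (2 : ℝ) ^ p < 2 := by
    simpa using Real.rpow_lt_rpow_of_exponent_lt one_lt_two hp1
  have hr : (2 : ℝ) ^ p / 2 < 1 := by linarith
  let u : E → ℕ → E' := fun x n => ((2 : ℝ) ^ n)⁻¹ • f ((2 ^ n : ℝ) • x)
  have hdist : ∀ x n, dist (u x n) (u x (n + 1)) ≤ ε * ‖x‖ ^ p * ((2 : ℝ) ^ p / 2) ^ n := by
    intro x n
    have h1 := hf ((2 ^ n : ℝ) • x) ((2 ^ n : ℝ) • x)
    rw [norm_two_pow_smul_rpow] at h1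
    have h2 := norm_inv_two_pow_smul_le (p := p) (n := n) (A := 2 * (ε * ‖x‖ ^ p))
      (h1.trans_eq (by ring))
    have h3 : u x (n + 1) - u x n = (2 : ℝ)⁻¹ • (((2 : ℝ) ^ n)⁻¹ •
        (f ((2 ^ n : ℝ) • x + (2 ^ n : ℝ) • x) - f ((2 ^ n : ℝ) • x) - f ((2 ^ n : ℝ) • x))) := by
      have h4 : (2 ^ (n + 1) : ℝ) • x = (2 ^ n : ℝ) • x + (2 ^ n : ℝ) • x := by
        rw [← add_smul]; congr 1; ring
      simp only [u]
      rw [h4, pow_succ, mul_inv]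
      module
    rw [dist_comm, dist_eq_norm, h3, norm_smul, norm_inv, Real.norm_ofNat]
    linarith
  choose T hT using fun x =>
    cauchySeq_tendsto_of_complete (cauchySeq_of_le_geometric _ _ hr (hdist x))
  have hadd : ∀ x y, T (x + y) = T x + T y := by
    intro x y
    have hlim : Tendsto (fun n => u (x + y) n - u x n - u y n) atTop
        (𝓝 (T (x + y) - T x - T y)) := ((hT _).sub (hT x)).sub (hT y)
    have hzero : Tendsto (fun n => u (x + y) n - u x n - u y n) atTop (𝓝 0) := by
      refine squeeze_zero_norm
        (a := fun n => ε * (‖x‖ ^ p + ‖y‖ ^ p) * ((2 : ℝ) ^ p / 2) ^ n) (fun n => ?_) ?_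
      · have h1 := hf ((2 ^ n : ℝ) • x) ((2 ^ n : ℝ) • y)
        rw [norm_two_pow_smul_rpow, norm_two_pow_smul_rpow, ← mul_add, mul_left_comm] at h1
        simpa only [u, smul_sub, smul_add] using norm_inv_two_pow_smul_le h1
      · simpa using (tendsto_pow_atTop_nhds_zero_of_lt_one (by positivity) hr).const_mul
          (ε * (‖x‖ ^ p + ‖y‖ ^ p))
    have h0 := tendsto_nhds_unique hlim hzero
    rwa [sub_sub, sub_eq_zero] at h0
  have hbound : ∀ x, ‖f x - T x‖ ≤ 2 * ε / (2 - 2 ^ p) * ‖x‖ ^ p := by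
    intro x
    have h1 := dist_le_of_le_geometric_of_tendsto₀ _ _ hr (hdist x) (hT x)
    have h2 : ε * ‖x‖ ^ p / (1 - (2 : ℝ) ^ p / 2) = 2 * ε / (2 - 2 ^ p) * ‖x‖ ^ p := by
      have h3 : (2 : ℝ) - 2 ^ p ≠ 0 := by linarith
      have h4 : 1 - (2 : ℝ) ^ p / 2 = (2 - 2 ^ p) / 2 := by ring
      rw [h4]
      field_simp
    rw [h2, dist_eq_norm] at h1
    simpa [u] using h1
  refine ⟨T, ⟨hadd, hbound⟩, fun S ⟨hS, hSb⟩ => ?_⟩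
  refine eq_of_map_add_of_norm_sub_le (C := 2 * (2 * ε / (2 - 2 ^ p))) hp1 hS hadd fun x => ?_
  have h1 := norm_sub_le_norm_sub_add_norm_sub (S x) (f x) (T x)
  rw [norm_sub_rev (S x) (f x)] at h1
  linarith [hSb x, hbound x]
end

section
/- (Rassias' theorem, linearity part) Let E be a real normed vector space, E' a real Banach space, ε > 0, 0 ≤ p < 1, and let f : E → E' satisfy ‖f(x+y) − f(x) − f(y)‖ ≤ ε(‖x‖^p + ‖y‖^p) for all x, y ∈ E. If the function t ↦ f(tx) from ℝ into E' is continuous in real t for each fixed x ∈ E, then the unique additive mapping T : E → E' with ‖f(x) − T(x)‖ ≤ (2ε/(2 − 2^p))‖x‖^p for all x ∈ E is real-linear. -/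
/-- An additive map on the reals whose norm is dominated by a continuous function is real-linear. -/
theorem AddMonoidHom.map_real_smul_of_norm_le_continuous {F : Type*} [NormedAddCommGroup F]
    [NormedSpace ℝ F] (φ : ℝ →+ F) {g : ℝ → ℝ} (hg : Continuous g) (hφ : ∀ t, ‖φ t‖ ≤ g t)
    (c t : ℝ) : φ (c • t) = c • φ t := by
  have hcont : Continuous φ := by
    refine φ.continuous_of_isBounded_nhds_zero (Metric.closedBall_mem_nhds 0 one_pos) ?_
    obtain ⟨C, hC⟩ :=
      (isCompact_closedBall (0 : ℝ) 1).exists_bound_of_continuousOn hg.continuousOn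
    refine isBounded_iff_forall_norm_le.2 ⟨C, ?_⟩
    rintro _ ⟨s, hs, rfl⟩
    exact (hφ s).trans ((le_abs_self _).trans (hC s hs))
  exact map_real_smul φ hcont c t

/-- Rassias' theorem, linearity part: if `t ↦ f (t • x)` is continuous for each fixed `x`,
then the unique additive map `T` with the Rassias estimate is real-linear. -/
theorem stmt_7 {E E' : Type*} [NormedAddCommGroup E] [NormedSpace ℝ E]
    [NormedAddCommGroup E'] [NormedSpace ℝ E'] [CompleteSpace E']
    (ε p : ℝ) (hε : 0 < ε) (hp0 : 0 ≤ p) (hp1 : p < 1) (f : E → E')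
    (hf : ∀ x y : E, ‖f (x + y) - f x - f y‖ ≤ ε * (‖x‖ ^ p + ‖y‖ ^ p))
    (hcont : ∀ x : E, Continuous fun t : ℝ => f (t • x)) :
    ∀ T : E → E',
      ((∀ x y : E, T (x + y) = T x + T y) ∧
        ∀ x : E, ‖f x - T x‖ ≤ 2 * ε / (2 - 2 ^ p) * ‖x‖ ^ p) →
      ∀ (t : ℝ) (x : E), T (t • x) = t • T x := by
  rintro T ⟨hadd, hT⟩ t x
  let φ : ℝ →+ E' := AddMonoidHom.mk' (fun s => T (s • x)) fun a b => by rw [add_smul, hadd]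
  have hg : Continuous fun s : ℝ => ‖f (s • x)‖ + 2 * ε / (2 - 2 ^ p) * ‖s • x‖ ^ p :=
    (hcont x).norm.add <| continuous_const.mul <|
      (continuous_id.smul continuous_const).norm.rpow_const fun _ => Or.inr hp0
  have hφ (s : ℝ) : ‖φ s‖ ≤ ‖f (s • x)‖ + 2 * ε / (2 - 2 ^ p) * ‖s • x‖ ^ p :=
    (norm_le_norm_add_norm_sub (f (s • x)) (T (s • x))).trans (by gcongr; exact hT _)
  simpa [φ] using φ.map_real_smul_of_norm_le_continuous hg hφ t 1
end

section
/- (Bourgin's theorem) Let ε and δ be nonnegative real numbers, let X and Y be real Banach algebras with identity elements, and let f be a surjective mapping of X onto Y satisfying ‖f(x+y) − f(x) − f(y)‖ ≤ ε and ‖f(x·y) − f(x)f(y)‖ ≤ δ for all x, y ∈ X. Then f is a ring homomorphism of X onto Y, i.e., f(x+y) = f(x) + f(y) and f(x·y) = f(x)f(y) for all x, y ∈ X. -/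
open Filter Topology

/-- Hyers' theorem: an approximately additive map into a Banach space is uniformly close to the
additive map `x ↦ lim 2⁻ⁿ f (2ⁿ x)`. -/
theorem exists_additive_limit {E F : Type*} [AddCommGroup E] [Module ℝ E]
    [NormedAddCommGroup F] [NormedSpace ℝ F] [CompleteSpace F] {ε : ℝ} {f : E → F}
    (hadd : ∀ x y, ‖f (x + y) - f x - f y‖ ≤ ε) :
    ∃ T : E → F, (∀ x, Tendsto (fun n : ℕ => ((2 : ℝ) ^ n)⁻¹ • f ((2 : ℝ) ^ n • x)) atTop
      (𝓝 (T x))) ∧ (∀ x y, T (x + y) = T x + T y) ∧ ∀ x, ‖f x - T x‖ ≤ ε := by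
  have hpow : Tendsto (fun n : ℕ => ((2 : ℝ) ^ n)⁻¹) atTop (𝓝 0) := by
    simpa using tendsto_pow_atTop_nhds_zero_of_lt_one (r := (2 : ℝ)⁻¹) (by norm_num) (by norm_num)
  have hstep : ∀ x (n : ℕ), dist (((2 : ℝ) ^ n)⁻¹ • f ((2 : ℝ) ^ n • x))
      (((2 : ℝ) ^ (n + 1))⁻¹ • f ((2 : ℝ) ^ (n + 1) • x)) ≤ ε / 2 / 2 ^ n := by
    intro x n
    set z := (2 : ℝ) ^ n • x with hz
    have hz2 : (2 : ℝ) ^ (n + 1) • x = z + z := by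
      rw [hz, ← add_smul]; congr 1; ring
    have heq : ((2 : ℝ) ^ (n + 1))⁻¹ • f (z + z) - ((2 : ℝ) ^ n)⁻¹ • f z =
        ((2 : ℝ) ^ (n + 1))⁻¹ • (f (z + z) - f z - f z) := by
      have : ((2 : ℝ) ^ n)⁻¹ = ((2 : ℝ) ^ (n + 1))⁻¹ * 2 := by
        rw [pow_succ]; field_simp
      rw [this]; module
    rw [hz2, dist_comm, dist_eq_norm, heq, norm_smul, Real.norm_of_nonneg (by positivity)]
    calc ((2 : ℝ) ^ (n + 1))⁻¹ * ‖f (z + z) - f z - f z‖ ≤ ((2 : ℝ) ^ (n + 1))⁻¹ * ε := by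
          gcongr; exact hadd z z
      _ = ε / 2 / 2 ^ n := by rw [pow_succ]; field_simp
  choose T hT using fun x =>
    cauchySeq_tendsto_of_complete (cauchySeq_of_le_geometric_two (hstep x))
  refine ⟨T, hT, fun x y => ?_, fun x => ?_⟩
  · have hzero : Tendsto (fun n : ℕ => ((2 : ℝ) ^ n)⁻¹ • f ((2 : ℝ) ^ n • (x + y)) -
        ((2 : ℝ) ^ n)⁻¹ • f ((2 : ℝ) ^ n • x) - ((2 : ℝ) ^ n)⁻¹ • f ((2 : ℝ) ^ n • y)) atTop
        (𝓝 0) := by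
      refine squeeze_zero_norm (a := fun n : ℕ => ((2 : ℝ) ^ n)⁻¹ * ε) (fun n => ?_)
        (by simpa using hpow.mul_const ε)
      rw [← smul_sub, ← smul_sub, norm_smul, Real.norm_of_nonneg (by positivity), smul_add]
      gcongr
      exact hadd _ _
    have h := tendsto_nhds_unique (((hT (x + y)).sub (hT x)).sub (hT y)) hzero
    rwa [sub_sub, sub_eq_zero] at h
  · simpa [dist_eq_norm] using
      dist_le_of_le_geometric_two_of_tendsto₀ (hstep x) (hT x)

/-- Bourgin's theorem: a surjective map between unital real Banach algebras which is
approximately additive and approximately multiplicative is a ring homomorphism. -/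
theorem stmt_8 {X Y : Type*} [NormedRing X] [NormedAlgebra ℝ X] [CompleteSpace X]
    [NormedRing Y] [NormedAlgebra ℝ Y] [CompleteSpace Y]
    (ε δ : ℝ) (hε : 0 ≤ ε) (hδ : 0 ≤ δ) (f : X → Y) (hsurj : Function.Surjective f)
    (hadd : ∀ x y : X, ‖f (x + y) - f x - f y‖ ≤ ε)
    (hmul : ∀ x y : X, ‖f (x * y) - f x * f y‖ ≤ δ) :
    (∀ x y : X, f (x + y) = f x + f y) ∧ ∀ x y : X, f (x * y) = f x * f y := by
  obtain ⟨T, hT, hTadd, hfT⟩ := exists_additive_limit hadd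
  have hpow : Tendsto (fun n : ℕ => ((2 : ℝ) ^ n)⁻¹) atTop (𝓝 0) := by
    simpa using tendsto_pow_atTop_nhds_zero_of_lt_one (r := (2 : ℝ)⁻¹) (by norm_num) (by norm_num)
  have hTmul : ∀ x y, T (x * y) = f x * T y := by
    intro x y
    have hzero : Tendsto (fun n : ℕ => ((2 : ℝ) ^ n)⁻¹ • f ((2 : ℝ) ^ n • (x * y)) -
        f x * (((2 : ℝ) ^ n)⁻¹ • f ((2 : ℝ) ^ n • y))) atTop (𝓝 0) := by
      refine squeeze_zero_norm (a := fun n : ℕ => ((2 : ℝ) ^ n)⁻¹ * δ) (fun n => ?_)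
        (by simpa using hpow.mul_const δ)
      rw [mul_smul_comm, ← smul_sub, norm_smul, Real.norm_of_nonneg (by positivity),
        ← mul_smul_comm]
      gcongr
      exact hmul _ _
    exact sub_eq_zero.1 (tendsto_nhds_unique ((hT (x * y)).sub ((hT y).const_mul (f x))) hzero)
  obtain ⟨u, hu⟩ : ∃ u, IsUnit (T u) := by
    obtain ⟨u, hu⟩ := hsurj ((ε + 1) • (1 : Y))
    have hε1 : ε + 1 ≠ 0 := by positivity
    have hlt : ‖1 - (ε + 1)⁻¹ • T u‖ < 1 := by
      have heq : 1 - (ε + 1)⁻¹ • T u = (ε + 1)⁻¹ • (f u - T u) := by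
        rw [hu, smul_sub, inv_smul_smul₀ hε1]
      rw [heq, norm_smul, Real.norm_of_nonneg (by positivity), inv_mul_lt_iff₀ (by positivity)]
      linarith [hfT u]
    have hunit := isUnit_one_sub_of_norm_lt_one hlt
    rw [sub_sub_cancel] at hunit
    exact ⟨u, (isUnit_smul_iff (Units.mk0 _ (inv_ne_zero hε1)) (T u)).1 hunit⟩
  have hfadd : ∀ x y, f (x + y) = f x + f y := fun x y =>
    hu.mul_right_cancel (by rw [← hTmul, add_mul, hTadd, hTmul, hTmul, add_mul])
  refine ⟨hfadd, fun x y => hu.mul_right_cancel ?_⟩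
  rw [← hTmul, mul_assoc, hTmul, hTmul, mul_assoc]
end

section
/- (Theorem 2.2) Let A be a ring, (B, N) a fuzzy Banach algebra, and (C, N') a fuzzy normed linear space. Let φ : A × A → C be a function such that for some 0 < α < 2, N'(φ(2a, 2b), t) ≥ N'(α φ(a,b), t) for all a, b ∈ A and all t > 0. Suppose f : A → B is a function such that N(f(a+b) − f(a) − f(b), t) ≥ N'(φ(a,b), t) and N(f(a·b) − f(a)f(b), s) ≥ N'(φ(a,b), s) for all a, b ∈ A and all t, s > 0. Then there exists a unique ring homomorphism h : A → B (i.e., h(a+b) = h(a) + h(b) and h(a·b) = h(a)h(b) for all a, b ∈ A) such that N(f(a) − h(a), t) ≥ N'((2/(2−α)) φ(a,a), t) for all a ∈ A and all t > 0. -/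
open Filter Topology

/-- A fuzzy norm on a real linear space `X` (conditions (N1)–(N6), with values in `[0,1]`). -/
structure IsFuzzyNorm {X : Type*} [AddCommGroup X] [Module ℝ X] (N : X → ℝ → ℝ) : Prop where
  nonneg : ∀ (x : X) (a : ℝ), 0 ≤ N x a
  le_one : ∀ (x : X) (a : ℝ), N x a ≤ 1
  N1 : ∀ (x : X) (a : ℝ), a ≤ 0 → N x a = 0
  N2 : ∀ x : X, x = 0 ↔ ∀ a : ℝ, 0 < a → N x a = 1
  N3 : ∀ (x : X) (a b : ℝ), a ≠ 0 → N (a • x) b = N x (b / |a|)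
  N4 : ∀ (x y : X) (a b : ℝ), min (N x a) (N y b) ≤ N (x + y) (a + b)
  N5_mono : ∀ x : X, Monotone (N x)
  N5_lim : ∀ x : X, Tendsto (N x) atTop (𝓝 1)
  N6 : ∀ x : X, x ≠ 0 → Continuous (N x)

/-- Convergence of a sequence to `x` in a fuzzy normed linear space:
`lim_{n→∞} N (s n - x) a = 1` for all `a > 0`. -/
def FuzzyTendsto {X : Type*} [AddCommGroup X] [Module ℝ X] (N : X → ℝ → ℝ)
    (s : ℕ → X) (x : X) : Prop :=
  ∀ a : ℝ, 0 < a → Tendsto (fun n => N (s n - x) a) atTop (𝓝 1)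

/-- A sequence is Cauchy in a fuzzy normed linear space. -/
def FuzzyCauchy {X : Type*} [AddCommGroup X] [Module ℝ X] (N : X → ℝ → ℝ)
    (s : ℕ → X) : Prop :=
  ∀ ε : ℝ, 0 < ε → ∀ a : ℝ, 0 < a → ∃ n₀ : ℕ, ∀ n ≥ n₀, ∀ p : ℕ, 0 < p →
    1 - ε < N (s (n + p) - s n) a

/-- A fuzzy norm is complete if every Cauchy sequence converges. -/
def FuzzyComplete {X : Type*} [AddCommGroup X] [Module ℝ X] (N : X → ℝ → ℝ) : Prop :=
  ∀ s : ℕ → X, FuzzyCauchy N s → ∃ x : X, FuzzyTendsto N s x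

/-- A fuzzy Banach algebra: a real algebra with a complete fuzzy norm satisfying
`N (x*y) (a*b) ≥ min (N x a) (N y b)`. -/
structure IsFuzzyBanachAlgebra {X : Type*} [Ring X] [Algebra ℝ X] (N : X → ℝ → ℝ) : Prop where
  toIsFuzzyNorm : IsFuzzyNorm N
  complete : FuzzyComplete N
  mul : ∀ (x y : X) (a b : ℝ), min (N x a) (N y b) ≤ N (x * y) (a * b)

namespace IsFuzzyNorm

variable {X : Type*} [AddCommGroup X] [Module ℝ X] {N : X → ℝ → ℝ}

theorem apply_neg (hN : IsFuzzyNorm N) (x : X) (a : ℝ) : N (-x) a = N x a := by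
  have h := hN.N3 x (-1) a (by norm_num)
  simpa using h

theorem apply_zero (hN : IsFuzzyNorm N) {a : ℝ} (ha : 0 < a) : N 0 a = 1 :=
  (hN.N2 0).1 rfl a ha

theorem min_le_apply_sub (hN : IsFuzzyNorm N) (x y : X) (a b : ℝ) :
    min (N x a) (N y b) ≤ N (x - y) (a + b) := by
  have h := hN.N4 x (-y) a b
  rwa [hN.apply_neg, ← sub_eq_add_neg] at h

theorem apply_inv_two_pow_smul (hN : IsFuzzyNorm N) (n : ℕ) (x : X) (t : ℝ) :
    N (((2 : ℝ) ^ n)⁻¹ • x) t = N x (t * 2 ^ n) := by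
  rw [hN.N3 _ _ _ (by positivity), abs_of_pos (by positivity), div_inv_eq_mul]

theorem fuzzyTendsto_of_le (hN : IsFuzzyNorm N) {s : ℕ → X} {x : X} {g : ℝ → ℕ → ℝ}
    (hg : ∀ a, 0 < a → Tendsto (g a) atTop (𝓝 1))
    (hle : ∀ a, 0 < a → ∀ n, g a n ≤ N (s n - x) a) : FuzzyTendsto N s x := fun a ha =>
  tendsto_of_tendsto_of_tendsto_of_le_of_le (hg a ha) tendsto_const_nhds (hle a ha)
    fun _ => hN.le_one _ _

theorem tendsto_min {u v : ℕ → ℝ} (hu : Tendsto u atTop (𝓝 1)) (hv : Tendsto v atTop (𝓝 1)) :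
    Tendsto (fun n => min (u n) (v n)) atTop (𝓝 1) := by
  simpa using hu.min hv

theorem fuzzyTendsto_sub (hN : IsFuzzyNorm N) {s s' : ℕ → X} {x x' : X}
    (hs : FuzzyTendsto N s x) (hs' : FuzzyTendsto N s' x') :
    FuzzyTendsto N (fun n => s n - s' n) (x - x') := by
  refine hN.fuzzyTendsto_of_le (g := fun a n => min (N (s n - x) (a / 2)) (N (s' n - x') (a / 2)))
    (fun a ha => tendsto_min (hs _ (half_pos ha)) (hs' _ (half_pos ha))) fun a _ n => ?_
  have h := hN.min_le_apply_sub (s n - x) (s' n - x') (a / 2) (a / 2)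
  rwa [add_halves, sub_sub_sub_comm] at h

theorem fuzzyTendsto_unique (hN : IsFuzzyNorm N) {s : ℕ → X} {x y : X}
    (hx : FuzzyTendsto N s x) (hy : FuzzyTendsto N s y) : x = y := by
  have h := hN.fuzzyTendsto_sub hx hy
  rw [← sub_eq_zero, ← neg_eq_zero, hN.N2]
  intro a ha
  have h1 := h a ha
  simp only [sub_self, zero_sub] at h1
  exact tendsto_nhds_unique tendsto_const_nhds h1

end IsFuzzyNorm

theorem IsFuzzyBanachAlgebra.fuzzyTendsto_mul {X : Type*} [Ring X] [Algebra ℝ X]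
    {N : X → ℝ → ℝ} (hN : IsFuzzyBanachAlgebra N) {s s' : ℕ → X} {x x' : X}
    (hs : FuzzyTendsto N s x) (hs' : FuzzyTendsto N s' x') :
    FuzzyTendsto N (fun n => s n * s' n) (x * x') := by
  have hF := hN.toIsFuzzyNorm
  intro a ha
  refine tendsto_order.2 ⟨fun b hb => ?_, fun b hb =>
    Eventually.of_forall fun n => (hF.le_one _ _).trans_lt hb⟩
  obtain ⟨r, hr, hrx, hrx'⟩ : ∃ r : ℝ, 0 < r ∧ b < N x r ∧ b < N x' r :=
    ((eventually_gt_atTop 0).and (((hF.N5_lim x).eventually_const_lt hb).and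
      ((hF.N5_lim x').eventually_const_lt hb))).exists
  filter_upwards [(hs (a / 3) (by positivity)).eventually_const_lt hb,
    (hs' 1 one_pos).eventually_const_lt hb,
    (hs (a / 3 / r) (by positivity)).eventually_const_lt hb,
    (hs' (a / 3 / r) (by positivity)).eventually_const_lt hb] with n h1 h2 h3 h4
  have e : s n * s' n - x * x' =
      (s n - x) * (s' n - x') + (s n - x) * x' + x * (s' n - x') := by noncomm_ring
  have m1 := hN.mul (s n - x) (s' n - x') (a / 3) 1
  have m2 := hN.mul (s n - x) x' (a / 3 / r) r
  have m3 := hN.mul x (s' n - x') r (a / 3 / r)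
  rw [mul_one] at m1
  rw [div_mul_cancel₀ _ hr.ne'] at m2
  rw [mul_div_cancel₀ _ hr.ne'] at m3
  have k := hF.N4 _ _ _ _ |>.trans' (min_le_min
    (hF.N4 ((s n - x) * (s' n - x')) ((s n - x) * x') (a / 3) (a / 3)) m3)
  rw [← e, show a / 3 + a / 3 + a / 3 = a by ring] at k
  exact (lt_min (lt_min ((lt_min h1 h2).trans_le m1) ((lt_min h3 hrx').trans_le m2))
    (lt_min hrx h4)).trans_le k

section ControlFunction

variable {A : Type*} [Ring A] {C : Type*} [AddCommGroup C] [Module ℝ C] {N' : C → ℝ → ℝ}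
  {φ : A → A → C} {α : ℝ}

theorem IsFuzzyNorm.apply_le_of_two_mul (hN' : IsFuzzyNorm N') (hα0 : 0 < α)
    (hφ : ∀ (a b : A) (t : ℝ), 0 < t → N' (α • φ a b) t ≤ N' (φ (2 * a) (2 * b)) t)
    (a b : A) {t : ℝ} (ht : 0 < t) : N' (φ a b) (t / α) ≤ N' (φ (2 * a) (2 * b)) t := by
  have h := hφ a b t ht
  rwa [hN'.N3 _ _ _ hα0.ne', abs_of_pos hα0] at h

theorem IsFuzzyNorm.apply_le_of_two_pow_mul (hN' : IsFuzzyNorm N') (hα0 : 0 < α)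
    (hφ : ∀ (a b : A) (t : ℝ), 0 < t → N' (α • φ a b) t ≤ N' (φ (2 * a) (2 * b)) t)
    (a b : A) (n : ℕ) {t : ℝ} (ht : 0 < t) :
    N' (φ a b) (t / α ^ n) ≤ N' (φ (2 ^ n * a) (2 ^ n * b)) t := by
  induction n generalizing t with
  | zero => simp
  | succ n ih =>
    have h := (ih (div_pos ht hα0)).trans
      (hN'.apply_le_of_two_mul hα0 hφ (2 ^ n * a) (2 ^ n * b) ht)
    rwa [div_div, ← pow_succ', ← mul_assoc, ← mul_assoc, ← pow_succ'] at h

theorem IsFuzzyNorm.tendsto_apply_two_pow_mul (hN' : IsFuzzyNorm N') (hα0 : 0 < α) (hα2 : α < 2)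
    (hφ : ∀ (a b : A) (t : ℝ), 0 < t → N' (α • φ a b) t ≤ N' (φ (2 * a) (2 * b)) t)
    (a b : A) {t : ℝ} (ht : 0 < t) :
    Tendsto (fun n : ℕ => N' (φ (2 ^ n * a) (2 ^ n * b)) (t * 2 ^ n)) atTop (𝓝 1) := by
  have h1 : Tendsto (fun n : ℕ => t * (2 / α) ^ n) atTop atTop :=
    (tendsto_pow_atTop_atTop_of_one_lt ((one_lt_div hα0).2 hα2)).const_mul_atTop ht
  refine tendsto_of_tendsto_of_tendsto_of_le_of_le ((hN'.N5_lim (φ a b)).comp h1)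
    tendsto_const_nhds (fun n => ?_) fun _ => hN'.le_one _ _
  have h := hN'.apply_le_of_two_pow_mul hα0 hφ a b n (t := t * 2 ^ n) (by positivity)
  simpa only [Function.comp, div_pow, mul_div_assoc] using h

variable {B : Type*} [AddCommGroup B] [Module ℝ B] {N : B → ℝ → ℝ} {f : A → B}

theorem IsFuzzyNorm.apply_le_dyadic_sub (hN : IsFuzzyNorm N) (hN' : IsFuzzyNorm N')
    (hα0 : 0 < α) (hα2 : α < 2)
    (hφ : ∀ (a b : A) (t : ℝ), 0 < t → N' (α • φ a b) t ≤ N' (φ (2 * a) (2 * b)) t)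
    (hadd : ∀ (a b : A) (t : ℝ), 0 < t → N' (φ a b) t ≤ N (f (a + b) - f a - f b) t)
    (n : ℕ) (a : A) {t : ℝ} (ht : 0 < t) :
    N' (φ a a) ((2 - α) * t) ≤ N (((2 : ℝ) ^ n)⁻¹ • f (2 ^ n * a) - f a) t := by
  have h2α : 0 < 2 - α := sub_pos.2 hα2
  induction n generalizing a t with
  | zero => simpa [hN.apply_zero ht] using hN'.le_one _ _
  | succ n ih =>
    have h1 := (hN'.apply_le_of_two_mul hα0 hφ a a (t := (2 - α) * (α * t)) (by positivity)).trans
      (ih (2 * a) (t := α * t) (by positivity))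
    have h2 := hadd a a ((2 - α) * t) (by positivity)
    have k := hN.N4 (((2 : ℝ) ^ n)⁻¹ • f (2 ^ n * (2 * a)) - f (2 * a)) (f (a + a) - f a - f a)
      (α * t) ((2 - α) * t)
    rw [show (2 - α) * (α * t) / α = (2 - α) * t by field_simp] at h1
    have e : ((2 : ℝ) ^ (n + 1))⁻¹ • f (2 ^ (n + 1) * a) - f a = ((2 : ℝ) ^ 1)⁻¹ •
        (((2 : ℝ) ^ n)⁻¹ • f (2 ^ n * (2 * a)) - f (2 * a) + (f (a + a) - f a - f a)) := by
      rw [← mul_assoc, ← pow_succ, two_mul a]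
      module
    rw [e, hN.apply_inv_two_pow_smul, show t * 2 ^ 1 = α * t + (2 - α) * t by ring]
    exact (le_min h1 h2).trans k

theorem IsFuzzyNorm.fuzzyCauchy_dyadic (hN : IsFuzzyNorm N) (hN' : IsFuzzyNorm N')
    (hα0 : 0 < α) (hα2 : α < 2)
    (hφ : ∀ (a b : A) (t : ℝ), 0 < t → N' (α • φ a b) t ≤ N' (φ (2 * a) (2 * b)) t)
    (hadd : ∀ (a b : A) (t : ℝ), 0 < t → N' (φ a b) t ≤ N (f (a + b) - f a - f b) t) (a : A) :
    FuzzyCauchy N fun n => ((2 : ℝ) ^ n)⁻¹ • f (2 ^ n * a) := by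
  have h2α : 0 < 2 - α := sub_pos.2 hα2
  intro ε hε t ht
  obtain ⟨n₀, hn₀⟩ := eventually_atTop.1 ((hN'.tendsto_apply_two_pow_mul hα0 hα2 hφ a a
    (t := (2 - α) * t) (by positivity)).eventually_const_lt (sub_lt_self 1 hε))
  refine ⟨n₀, fun n hn p _ => (hn₀ n hn).trans_le ?_⟩
  have h := hN.apply_le_dyadic_sub hN' hα0 hα2 hφ hadd p (2 ^ n * a) (t := t * 2 ^ n)
    (by positivity)
  have e : ((2 : ℝ) ^ (n + p))⁻¹ • f (2 ^ (n + p) * a) - ((2 : ℝ) ^ n)⁻¹ • f (2 ^ n * a) =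
      ((2 : ℝ) ^ n)⁻¹ • (((2 : ℝ) ^ p)⁻¹ • f (2 ^ p * (2 ^ n * a)) - f (2 ^ n * a)) := by
    rw [← mul_assoc, ← pow_add, add_comm p n, smul_sub, smul_smul, ← mul_inv, ← pow_add]
  simp only [e]
  rwa [hN.apply_inv_two_pow_smul, mul_assoc]

end ControlFunction

theorem map_two_pow_mul_of_map_add {A B : Type*} [Ring A] [AddCommGroup B] [Module ℝ B]
    {h : A → B} (hadd : ∀ a b, h (a + b) = h a + h b) (n : ℕ) (a : A) :
    h (2 ^ n * a) = (2 : ℝ) ^ n • h a := by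
  induction n with
  | zero => simp
  | succ n ih =>
    rw [pow_succ', mul_assoc, two_mul, hadd, ih]
    module

/-- Theorem 2.2: fuzzy stability of ring homomorphisms. -/
theorem stmt_9 {A : Type*} [Ring A] {B : Type*} [Ring B] [Algebra ℝ B]
    {C : Type*} [AddCommGroup C] [Module ℝ C]
    (N : B → ℝ → ℝ) (N' : C → ℝ → ℝ)
    (hN : IsFuzzyBanachAlgebra N) (hN' : IsFuzzyNorm N')
    (φ : A → A → C) (α : ℝ) (hα0 : 0 < α) (hα2 : α < 2)
    (hφ : ∀ (a b : A) (t : ℝ), 0 < t → N' (α • φ a b) t ≤ N' (φ (2 * a) (2 * b)) t)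
    (f : A → B)
    (hadd : ∀ (a b : A) (t : ℝ), 0 < t → N' (φ a b) t ≤ N (f (a + b) - f a - f b) t)
    (hmul : ∀ (a b : A) (s : ℝ), 0 < s → N' (φ a b) s ≤ N (f (a * b) - f a * f b) s) :
    ∃! h : A → B,
      ((∀ a b : A, h (a + b) = h a + h b) ∧ (∀ a b : A, h (a * b) = h a * h b)) ∧
      ∀ (a : A) (t : ℝ), 0 < t → N' ((2 / (2 - α)) • φ a a) t ≤ N (f a - h a) t := by
  have hF := hN.toIsFuzzyNorm
  have h2α : 0 < 2 - α := sub_pos.2 hα2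
  have hscale : ∀ (x : C) (t : ℝ), N' ((2 / (2 - α)) • x) t = N' x ((2 - α) * (t / 2)) := by
    intro x t
    rw [hN'.N3 _ _ _ (by positivity), abs_of_pos (by positivity)]
    congr 1
    field_simp
  choose h hh using fun a =>
    hN.complete _ (hF.fuzzyCauchy_dyadic hN' hα0 hα2 hφ hadd a)
  refine ⟨h, ⟨⟨fun a b => ?_, fun a b => ?_⟩, fun a t ht => ?_⟩, ?_⟩
  · have h1 := hF.fuzzyTendsto_sub (hF.fuzzyTendsto_sub (hh (a + b)) (hh a)) (hh b)
    have h2 := hF.fuzzyTendsto_of_le (x := 0)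
      (s := fun n => ((2 : ℝ) ^ n)⁻¹ • f (2 ^ n * (a + b)) - ((2 : ℝ) ^ n)⁻¹ • f (2 ^ n * a)
        - ((2 : ℝ) ^ n)⁻¹ • f (2 ^ n * b))
      (fun t ht => hN'.tendsto_apply_two_pow_mul hα0 hα2 hφ a b ht) fun t ht n => by
        rw [sub_zero, ← smul_sub, ← smul_sub, hF.apply_inv_two_pow_smul, mul_add]
        exact hadd _ _ _ (by positivity)
    have h3 := hF.fuzzyTendsto_unique h1 h2
    rwa [sub_sub, sub_eq_zero] at h3
  · have hdouble : FuzzyTendsto N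
        (fun n => ((2 : ℝ) ^ (2 * n))⁻¹ • f (2 ^ (2 * n) * (a * b))) (h (a * b)) := fun t ht =>
      (hh (a * b) t ht).comp (tendsto_id.const_mul_atTop' two_pos)
    have h1 := hF.fuzzyTendsto_sub hdouble (hN.fuzzyTendsto_mul (hh a) (hh b))
    have h2 := hF.fuzzyTendsto_of_le (x := 0)
      (s := fun n => ((2 : ℝ) ^ (2 * n))⁻¹ • f (2 ^ (2 * n) * (a * b)) -
        (((2 : ℝ) ^ n)⁻¹ • f (2 ^ n * a)) * (((2 : ℝ) ^ n)⁻¹ • f (2 ^ n * b)))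
      (fun t ht => hN'.tendsto_apply_two_pow_mul hα0 hα2 hφ a b ht) fun t ht n => by
        have e : (2 : A) ^ (2 * n) * (a * b) = 2 ^ n * a * (2 ^ n * b) := by
          have hc : Commute ((2 : A) ^ n) a := (Commute.ofNat_left 2 a).pow_left n
          rw [two_mul, pow_add, mul_assoc, ← mul_assoc _ a b, hc.eq]
          simp only [mul_assoc]
          rw [← mul_assoc, hc.eq, mul_assoc]
        rw [sub_zero, smul_mul_smul_comm, ← mul_inv, ← pow_add, ← two_mul, ← smul_sub,
          hF.apply_inv_two_pow_smul, e]
        refine (hN'.N5_mono _ ?_).trans (hmul _ _ _ (by positivity))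
        gcongr
        · norm_num
        · omega
    exact sub_eq_zero.1 (hF.fuzzyTendsto_unique h1 h2)
  · have hlim := hh a (t / 2) (half_pos ht)
    have hmin : Tendsto (fun n : ℕ => min (N' ((2 / (2 - α)) • φ a a) t)
        (N (((2 : ℝ) ^ n)⁻¹ • f (2 ^ n * a) - h a) (t / 2))) atTop
        (𝓝 (min (N' ((2 / (2 - α)) • φ a a) t) 1)) := tendsto_const_nhds.min hlim
    rw [min_eq_left (hN'.le_one _ _)] at hmin
    refine le_of_tendsto' hmin fun n => ?_
    have k := hF.N4 (f a - ((2 : ℝ) ^ n)⁻¹ • f (2 ^ n * a))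
      (((2 : ℝ) ^ n)⁻¹ • f (2 ^ n * a) - h a) (t / 2) (t / 2)
    rw [sub_add_sub_cancel, add_halves] at k
    refine (min_le_min_right _ ?_).trans k
    rw [hscale, ← hF.apply_neg, neg_sub]
    exact hF.apply_le_dyadic_sub hN' hα0 hα2 hφ hadd n a (half_pos ht)
  · rintro g ⟨⟨hgadd, -⟩, hg⟩
    funext a
    refine (hF.fuzzyTendsto_unique (hh a) ?_).symm
    refine hF.fuzzyTendsto_of_le (g := fun t n =>
      N' (φ (2 ^ n * a) (2 ^ n * a)) ((2 - α) * (t / 2) * 2 ^ n))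
      (fun t ht => hN'.tendsto_apply_two_pow_mul hα0 hα2 hφ a a (by positivity)) fun t ht n => ?_
    have k := hg (2 ^ n * a) (t * 2 ^ n) (by positivity)
    rw [hscale, map_two_pow_mul_of_map_add hgadd] at k
    have e : ((2 : ℝ) ^ n)⁻¹ • f (2 ^ n * a) - g a =
        ((2 : ℝ) ^ n)⁻¹ • (f (2 ^ n * a) - (2 : ℝ) ^ n • g a) := by
      rw [smul_sub, inv_smul_smul₀ (by positivity)]
    rw [e, hF.apply_inv_two_pow_smul]
    convert k using 2
    ring
end

section
/- (Uniqueness step of Theorem 2.2) Let A be a ring, (B, N) a fuzzy Banach algebra, (C, N') a fuzzy normed linear space, and φ : A × A → C a function such that for some 0 < α < 2, N'(φ(2a, 2b), t) ≥ N'(α φ(a,b), t) for all a, b ∈ A and t > 0. Let f : A → B be any function, and suppose h, h' : A → B are additive maps each satisfying N(f(a) − h(a), t) ≥ N'((2/(2−α)) φ(a,a), t) and N(f(a) − h'(a), t) ≥ N'((2/(2−α)) φ(a,a), t) for all a ∈ A and all t > 0. Then h(a) = h'(a) for all a ∈ A. -/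
open Filter Topology

/-- A fuzzy norm is invariant under negation. -/
theorem IsFuzzyNorm.neg {X : Type*} [AddCommGroup X] [Module ℝ X] {N : X → ℝ → ℝ}
    (hN : IsFuzzyNorm N) (x : X) (t : ℝ) : N (-x) t = N x t := by
  simpa using hN.N3 x (-1) t (by norm_num)

/-- The triangle inequality for a fuzzy norm, through an intermediate point. -/
theorem IsFuzzyNorm.min_le_sub {X : Type*} [AddCommGroup X] [Module ℝ X] {N : X → ℝ → ℝ}
    (hN : IsFuzzyNorm N) (x y z : X) (s t : ℝ) :
    min (N (z - x) s) (N (z - y) t) ≤ N (x - y) (s + t) := by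
  have key := hN.N4 (-(z - x)) (z - y) s t
  rwa [hN.neg, neg_sub, sub_add_sub_cancel] at key

/-- Iterating the contraction property of the control function along powers of two. -/
theorem IsFuzzyNorm.le_control_two_pow {A C : Type*} [Ring A] [AddCommGroup C] [Module ℝ C]
    {N : C → ℝ → ℝ} (hN : IsFuzzyNorm N) {φ : A → A → C} {α : ℝ} (hα : 0 < α)
    (hφ : ∀ (a b : A) (t : ℝ), 0 < t → N (α • φ a b) t ≤ N (φ (2 * a) (2 * b)) t)
    (a b : A) (n : ℕ) {t : ℝ} (ht : 0 < t) :
    N (φ a b) (t / α ^ n) ≤ N (φ (2 ^ n • a) (2 ^ n • b)) t := by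
  induction n generalizing t with
  | zero => simp
  | succ n ih =>
    have double (x : A) : 2 ^ (n + 1) • x = 2 * (2 ^ n • x) := by
      rw [pow_succ', mul_smul, two_nsmul, two_mul]
    rw [double, double]
    calc N (φ a b) (t / α ^ (n + 1)) = N (φ a b) (t / α / α ^ n) := by
          rw [pow_succ', div_div]
      _ ≤ N (φ (2 ^ n • a) (2 ^ n • b)) (t / α) := ih (by positivity)
      _ = N (α • φ (2 ^ n • a) (2 ^ n • b)) t := by rw [hN.N3 _ _ _ hα.ne', abs_of_pos hα]
      _ ≤ _ := hφ _ _ _ ht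

/-- Uniqueness step of Theorem 2.2: two additive maps both approximating `f` in the
fuzzy sense coincide. -/
theorem stmt_12 {A : Type*} [Ring A] {B : Type*} [Ring B] [Algebra ℝ B]
    {C : Type*} [AddCommGroup C] [Module ℝ C]
    (N : B → ℝ → ℝ) (N' : C → ℝ → ℝ)
    (hN : IsFuzzyBanachAlgebra N) (hN' : IsFuzzyNorm N')
    (φ : A → A → C) (α : ℝ) (hα0 : 0 < α) (hα2 : α < 2)
    (hφ : ∀ (a b : A) (t : ℝ), 0 < t → N' (α • φ a b) t ≤ N' (φ (2 * a) (2 * b)) t)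
    (f h h' : A → B)
    (hhadd : ∀ a b : A, h (a + b) = h a + h b)
    (hh'add : ∀ a b : A, h' (a + b) = h' a + h' b)
    (hclose : ∀ (a : A) (t : ℝ), 0 < t → N' ((2 / (2 - α)) • φ a a) t ≤ N (f a - h a) t)
    (hclose' : ∀ (a : A) (t : ℝ), 0 < t → N' ((2 / (2 - α)) • φ a a) t ≤ N (f a - h' a) t) :
    ∀ a : A, h a = h' a := by
  intro a
  have hB := hN.toIsFuzzyNorm
  have hc : 0 < 2 / (2 - α) := div_pos two_pos (sub_pos.2 hα2)
  set c := 2 / (2 - α)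
  have map_two_pow (g : A → B) (hg : ∀ a b, g (a + b) = g a + g b) (n : ℕ) :
      g (2 ^ n • a) = (2 ^ n : ℝ) • g a := by
    rw [← AddMonoidHom.mk'_apply g hg, map_nsmul, ← Nat.cast_smul_eq_nsmul ℝ]
    simp
  rw [← sub_eq_zero, hB.N2]
  intro t ht
  refine le_antisymm (hB.le_one _ _) ?_
  have lower (n : ℕ) : N' (φ a a) ((2 / α) ^ n * (t / 2 / c)) ≤ N (h a - h' a) t := by
    have hs : 0 < 2 ^ n * t / 2 := by positivity
    have htwo : (0 : ℝ) < 2 ^ n := by positivity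
    calc N' (φ a a) ((2 / α) ^ n * (t / 2 / c))
        = N' (φ a a) (2 ^ n * t / 2 / c / α ^ n) := by
          congr 1
          rw [div_pow]
          ring
      _ ≤ N' (φ (2 ^ n • a) (2 ^ n • a)) (2 ^ n * t / 2 / c) :=
          hN'.le_control_two_pow hα0 hφ a a n (by positivity)
      _ = N' (c • φ (2 ^ n • a) (2 ^ n • a)) (2 ^ n * t / 2) := by
          rw [hN'.N3 _ _ _ hc.ne', abs_of_pos hc]
      _ ≤ N (h (2 ^ n • a) - h' (2 ^ n • a)) (2 ^ n * t / 2 + 2 ^ n * t / 2) :=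
          (le_min (hclose _ _ hs) (hclose' _ _ hs)).trans (hB.min_le_sub _ _ _ _ _)
      _ = N (h a - h' a) t := by
          rw [map_two_pow h hhadd, map_two_pow h' hh'add, ← smul_sub, add_halves,
            hB.N3 _ _ _ htwo.ne', abs_of_pos htwo, mul_div_cancel_left₀ _ htwo.ne']
  have grow : Tendsto (fun n : ℕ => (2 / α) ^ n * (t / 2 / c)) atTop atTop :=
    (tendsto_pow_atTop_atTop_of_one_lt ((one_lt_div hα0).2 hα2)).atTop_mul_const (by positivity)
  exact le_of_tendsto' ((hN'.N5_lim (φ a a)).comp grow) lower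
end

section
/- (Uniqueness step of Theorem 3.1) Let (A, N) be a fuzzy Banach algebra and (B, N') a fuzzy normed linear space. Let φ : A × A → B be a function such that for some 0 < α < 2, N'(φ(2a, 2b), t) ≥ N'(α φ(a,b), t) for all a, b ∈ A and t > 0. Let f : A → A be any function, and suppose d, d' : A → A are additive maps each satisfying N(f(a) − d(a), t) ≥ N'((2/(2−α)) φ(a,a), t) and N(f(a) − d'(a), t) ≥ N'((2/(2−α)) φ(a,a), t) for all a ∈ A and all t > 0. Then d(a) = d'(a) for all a ∈ A. -/
open Filter Topology

namespace IsFuzzyNorm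

variable {X : Type*} [AddCommGroup X] [Module ℝ X] {N : X → ℝ → ℝ}

theorem sub_comm (hN : IsFuzzyNorm N) (x y : X) (t : ℝ) : N (x - y) t = N (y - x) t := by
  have h := hN.N3 (y - x) (-1) t (by norm_num)
  simpa using h

theorem min_le_sub_s16 (hN : IsFuzzyNorm N) (x y z : X) (s t : ℝ) :
    min (N (z - x) s) (N (z - y) t) ≤ N (x - y) (s + t) := by
  have h := hN.N4 (x - z) (z - y) s t
  rwa [sub_add_sub_cancel, hN.sub_comm x z] at h

end IsFuzzyNorm

theorem map_two_pow_mul_of_additive {A : Type*} [Ring A] [Algebra ℝ A] {d : A → A}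
    (hd : ∀ a b : A, d (a + b) = d a + d b) (a : A) (n : ℕ) :
    d (2 ^ n * a) = (2 : ℝ) ^ n • d a := by
  induction n with
  | zero => simp
  | succ n ih => rw [pow_succ', mul_assoc, two_mul, hd, ih, pow_succ', mul_smul, two_smul]

theorem IsFuzzyNorm.le_apply_two_pow_mul {A : Type*} [Ring A]
    {B : Type*} [AddCommGroup B] [Module ℝ B] {N : B → ℝ → ℝ} (hN : IsFuzzyNorm N)
    {φ : A → A → B} {α : ℝ} (hα : 0 < α)
    (hφ : ∀ (a b : A) (t : ℝ), 0 < t → N (α • φ a b) t ≤ N (φ (2 * a) (2 * b)) t)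
    (a b : A) (n : ℕ) {t : ℝ} (ht : 0 < t) :
    N (φ a b) (t / α ^ n) ≤ N (φ (2 ^ n * a) (2 ^ n * b)) t := by
  induction n generalizing t with
  | zero => simp
  | succ n ih =>
    have h := hφ (2 ^ n * a) (2 ^ n * b) t ht
    rw [hN.N3 _ _ _ hα.ne', abs_of_pos hα] at h
    rw [pow_succ' 2, mul_assoc, mul_assoc, pow_succ' α, ← div_div]
    exact (ih (div_pos ht hα)).trans h

/-- Uniqueness step of Theorem 3.1: two additive maps both approximating `f` in the
fuzzy sense coincide. -/
theorem stmt_16 {A : Type*} [Ring A] [Algebra ℝ A]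
    {B : Type*} [AddCommGroup B] [Module ℝ B]
    (N : A → ℝ → ℝ) (N' : B → ℝ → ℝ)
    (hN : IsFuzzyBanachAlgebra N) (hN' : IsFuzzyNorm N')
    (φ : A → A → B) (α : ℝ) (hα0 : 0 < α) (hα2 : α < 2)
    (hφ : ∀ (a b : A) (t : ℝ), 0 < t → N' (α • φ a b) t ≤ N' (φ (2 * a) (2 * b)) t)
    (f d d' : A → A)
    (hdadd : ∀ a b : A, d (a + b) = d a + d b)
    (hd'add : ∀ a b : A, d' (a + b) = d' a + d' b)
    (hclose : ∀ (a : A) (t : ℝ), 0 < t → N' ((2 / (2 - α)) • φ a a) t ≤ N (f a - d a) t)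
    (hclose' : ∀ (a : A) (t : ℝ), 0 < t → N' ((2 / (2 - α)) • φ a a) t ≤ N (f a - d' a) t) :
    ∀ a : A, d a = d' a := by
  intro a
  have hNA := hN.toIsFuzzyNorm
  have hc : 0 < 2 / (2 - α) := div_pos two_pos (sub_pos.2 hα2)
  set c := 2 / (2 - α)
  rw [← sub_eq_zero, hNA.N2]
  intro t ht
  have bound : ∀ n : ℕ, N' (φ a a) ((2 / α) ^ n * (t / 2 / c)) ≤ N (d a - d' a) t := by
    intro n
    have hs : 0 < 2 ^ n * (t / 2) := by positivity
    have hmin := le_min (hclose (2 ^ n * a) _ hs) (hclose' (2 ^ n * a) _ hs)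
    have hsub := hmin.trans (hNA.min_le_sub_s16 _ _ _ _ _)
    rw [map_two_pow_mul_of_additive hdadd, map_two_pow_mul_of_additive hd'add, ← smul_sub,
      hNA.N3 _ _ _ (by positivity), abs_of_pos (by positivity), ← mul_add, add_halves,
      mul_div_cancel_left₀ _ (by positivity), hN'.N3 _ _ _ hc.ne', abs_of_pos hc] at hsub
    have hiter := hN'.le_apply_two_pow_mul hα0 hφ a a n (div_pos hs hc)
    have heq : 2 ^ n * (t / 2) / c / α ^ n = (2 / α) ^ n * (t / 2 / c) := by
      rw [div_pow]
      ring
    rw [heq] at hiter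
    exact hiter.trans hsub
  have hlim : Tendsto (fun n : ℕ => (2 / α) ^ n * (t / 2 / c)) atTop atTop :=
    (tendsto_pow_atTop_atTop_of_one_lt ((one_lt_div hα0).2 hα2)).atTop_mul_const (by positivity)
  exact le_antisymm (hNA.le_one _ _) (le_of_tendsto' ((hN'.N5_lim _).comp hlim) bound)
end

section
/- (Rassias' theorem for p > 1, Gajda's extension) Let E be a real normed vector space, E' a real Banach space, and let f : E → E' satisfy ‖f(x+y) − f(x) − f(y)‖ ≤ ε(‖x‖^p + ‖y‖^p) for all x, y ∈ E, where ε > 0 and p > 1 are constants. Then there exists a unique additive mapping T : E → E' such that ‖f(x) − T(x)‖ ≤ (2ε/(2^p − 2))‖x‖^p for all x ∈ E. -/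
open Filter Topology

lemma two_pow_mul_norm_inv_smul_rpow {E : Type*} [NormedAddCommGroup E] [NormedSpace ℝ E]
    (p : ℝ) (n : ℕ) (x : E) :
    (2 : ℝ) ^ n * ‖((2 : ℝ) ^ n)⁻¹ • x‖ ^ p = (2 / 2 ^ p) ^ n * ‖x‖ ^ p := by
  have h : ((2 : ℝ) ^ n) ^ p = (2 ^ p) ^ n := by
    rw [← Real.rpow_natCast, ← Real.rpow_natCast, ← Real.rpow_mul (by norm_num),
      ← Real.rpow_mul (by norm_num), mul_comm]
  rw [norm_smul, norm_inv, norm_pow, Real.norm_ofNat,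
    Real.mul_rpow (by positivity) (norm_nonneg x), Real.inv_rpow (by positivity), h, div_pow]
  ring

lemma two_lt_two_rpow {p : ℝ} (hp : 1 < p) : (2 : ℝ) < 2 ^ p := by
  simpa using Real.rpow_lt_rpow_of_exponent_lt (x := 2) (by norm_num) hp

lemma tendsto_two_div_two_rpow_pow_mul {p : ℝ} (hp : 1 < p) (c : ℝ) :
    Tendsto (fun n : ℕ => ((2 : ℝ) / 2 ^ p) ^ n * c) atTop (𝓝 0) := by
  have h := two_lt_two_rpow hp
  have h1 : (2 : ℝ) / 2 ^ p < 1 := (div_lt_one (by linarith)).2 h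
  simpa using (tendsto_pow_atTop_nhds_zero_of_lt_one (by positivity) h1).mul_const c

/-- An additive map within `C * ‖x‖ ^ p` of `f`, where `p > 1`, is the pointwise limit of the
rescalings `2 ^ n • f (2 ^ (-n) • x)`. -/
lemma tendsto_rescale_of_additive {E E' : Type*} [NormedAddCommGroup E] [NormedSpace ℝ E]
    [NormedAddCommGroup E'] [NormedSpace ℝ E'] {p C : ℝ} (hp : 1 < p) {f T : E → E'}
    (hadd : ∀ x y : E, T (x + y) = T x + T y) (hT : ∀ x : E, ‖f x - T x‖ ≤ C * ‖x‖ ^ p) (x : E) :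
    Tendsto (fun n : ℕ => (2 : ℝ) ^ n • f (((2 : ℝ) ^ n)⁻¹ • x)) atTop (𝓝 (T x)) := by
  have hpow : ∀ (n : ℕ) (z : E), T ((2 : ℝ) ^ n • z) = (2 : ℝ) ^ n • T z := by
    intro n
    induction n with
    | zero => simp
    | succ k ih =>
      intro z
      rw [pow_succ, mul_smul, ih, two_smul, hadd, ← two_smul ℝ (T z), ← mul_smul]
  rw [tendsto_iff_norm_sub_tendsto_zero]
  refine squeeze_zero (fun _ => norm_nonneg _) (fun n => ?_)
    (tendsto_two_div_two_rpow_pow_mul hp (‖x‖ ^ p * C))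
  have hx : T x = (2 : ℝ) ^ n • T (((2 : ℝ) ^ n)⁻¹ • x) := by
    rw [← hpow, smul_inv_smul₀ (by positivity)]
  calc ‖(2 : ℝ) ^ n • f (((2 : ℝ) ^ n)⁻¹ • x) - T x‖
      = 2 ^ n * ‖f (((2 : ℝ) ^ n)⁻¹ • x) - T (((2 : ℝ) ^ n)⁻¹ • x)‖ := by
        rw [hx, ← smul_sub, norm_smul, norm_pow, Real.norm_ofNat]
    _ ≤ 2 ^ n * (C * ‖((2 : ℝ) ^ n)⁻¹ • x‖ ^ p) := by gcongr; exact hT _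
    _ = (2 ^ n * ‖((2 : ℝ) ^ n)⁻¹ • x‖ ^ p) * C := by ring
    _ = _ := by rw [two_pow_mul_norm_inv_smul_rpow, mul_assoc]

/-- Rassias' theorem for `p > 1` (Gajda's extension). -/
theorem stmt_17 {E E' : Type*} [NormedAddCommGroup E] [NormedSpace ℝ E]
    [NormedAddCommGroup E'] [NormedSpace ℝ E'] [CompleteSpace E']
    (ε p : ℝ) (hε : 0 < ε) (hp : 1 < p) (f : E → E')
    (hf : ∀ x y : E, ‖f (x + y) - f x - f y‖ ≤ ε * (‖x‖ ^ p + ‖y‖ ^ p)) :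
    ∃! T : E → E', (∀ x y : E, T (x + y) = T x + T y) ∧
      ∀ x : E, ‖f x - T x‖ ≤ 2 * ε / (2 ^ p - 2) * ‖x‖ ^ p := by
  have h2 := two_lt_two_rpow hp
  have hr1 : (2 : ℝ) / 2 ^ p < 1 := (div_lt_one (by linarith)).2 h2
  set u : E → ℕ → E' := fun x n => (2 : ℝ) ^ n • f (((2 : ℝ) ^ n)⁻¹ • x) with hu
  have hstep : ∀ (x : E) (n : ℕ),
      dist (u x n) (u x (n + 1)) ≤ 2 * ε / 2 ^ p * ‖x‖ ^ p * (2 / 2 ^ p) ^ n := by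
    intro x n
    set w := ((2 : ℝ) ^ (n + 1))⁻¹ • x with hw
    have hz : ((2 : ℝ) ^ n)⁻¹ • x = w + w := by
      rw [hw, ← two_smul ℝ, smul_smul]
      congr 1
      field_simp
      ring
    have hd : u x n - u x (n + 1) = (2 : ℝ) ^ n • (f (w + w) - f w - f w) := by
      simp only [hu]
      rw [hz, ← hw, pow_succ, mul_smul, two_smul, sub_sub, smul_sub]
    have hs := two_pow_mul_norm_inv_smul_rpow p (n + 1) x
    rw [← hw] at hs
    calc dist (u x n) (u x (n + 1)) = 2 ^ n * ‖f (w + w) - f w - f w‖ := by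
          rw [dist_eq_norm, hd, norm_smul, norm_pow, Real.norm_ofNat]
      _ ≤ 2 ^ n * (ε * (‖w‖ ^ p + ‖w‖ ^ p)) := by gcongr; exact hf w w
      _ = ε * (2 ^ (n + 1) * ‖w‖ ^ p) := by ring
      _ = _ := by rw [hs]; ring
  choose T hT using fun x => cauchySeq_tendsto_of_complete
    (cauchySeq_of_le_geometric _ _ hr1 (hstep x))
  refine ⟨T, ⟨fun x y => ?_, fun x => ?_⟩, fun S hS => funext fun x =>
    tendsto_nhds_unique (tendsto_rescale_of_additive hp hS.1 hS.2 x) (hT x)⟩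
  · have hlim : Tendsto (fun n => u (x + y) n - u x n - u y n) atTop (𝓝 0) := by
      refine squeeze_zero_norm (fun n => ?_)
        (tendsto_two_div_two_rpow_pow_mul hp (ε * (‖x‖ ^ p + ‖y‖ ^ p)))
      have hx := two_pow_mul_norm_inv_smul_rpow p n x
      have hy := two_pow_mul_norm_inv_smul_rpow p n y
      calc ‖u (x + y) n - u x n - u y n‖
          = 2 ^ n * ‖f (((2 : ℝ) ^ n)⁻¹ • x + ((2 : ℝ) ^ n)⁻¹ • y) - f (((2 : ℝ) ^ n)⁻¹ • x)
              - f (((2 : ℝ) ^ n)⁻¹ • y)‖ := by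
            simp only [hu]
            rw [← smul_sub, ← smul_sub, norm_smul, norm_pow, Real.norm_ofNat, smul_add]
        _ ≤ 2 ^ n * (ε * (‖((2 : ℝ) ^ n)⁻¹ • x‖ ^ p + ‖((2 : ℝ) ^ n)⁻¹ • y‖ ^ p)) := by
            gcongr
            exact hf _ _
        _ = (2 / 2 ^ p) ^ n * (ε * (‖x‖ ^ p + ‖y‖ ^ p)) := by
            linear_combination ε * hx + ε * hy
    have h := tendsto_nhds_unique (((hT (x + y)).sub (hT x)).sub (hT y)) hlim
    rwa [sub_sub, sub_eq_zero] at h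
  · have h := dist_le_of_le_geometric_of_tendsto₀ _ _ hr1 (hstep x) (hT x)
    have h0 : u x 0 = f x := by simp [hu]
    rw [h0, dist_eq_norm] at h
    refine h.trans_eq ?_
    have hne : (2 : ℝ) ^ p - 2 ≠ 0 := by linarith
    have hp0 : (2 : ℝ) ^ p ≠ 0 := by positivity
    rw [one_sub_div hp0]
    field_simp
end
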